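/- arXiv:0711.4486 — 3 statements merged into one kernel-verified Lean document; each statement's English description precedes it below -/
import Mathlib

section
/- Almost surely, |A_n| → |A| as n → ∞; that is, the Lebesgue measure of the Voronoi estimator A_n converges almost surely to the Lebesgue measure of A. (This is the first assertion of Theorem 5.1.) -/
open MeasureTheory ProbabilityTheory Filter Topology
open scoped RealInnerProductSpace

noncomputable section

/-- Euclidean space `ℝ^d`. -/
abbrev EucSp (d : ℕ) := EuclideanSpace ℝ (Fin d)

/-- The closed Voronoi cell of `x` relative to the point set `S`:
all points at least as close to `x` as to any point of `S`. -/
def vorCell {d : ℕ} (x : EucSp d) (S : Set (EucSp d)) : Set (EucSp d) :=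
  {y | ∀ z ∈ S, dist y x ≤ dist y z}

/-- The open unit cube `(0,1)^d`. -/
def unitCube (d : ℕ) : Set (EucSp d) := {x | ∀ i, x i ∈ Set.Ioo (0 : ℝ) 1}

/-- The sample set `𝒳_n = {X_0, …, X_{n-1}}` at outcome `ω`. -/
def sample {d : ℕ} {Ωp : Type*} (X : ℕ → Ωp → EucSp d) (n : ℕ) (ω : Ωp) :
    Set (EucSp d) :=
  (fun i => X i ω) '' Set.Iio n

/-- The Voronoi estimator `A_n = ⋃_{x ∈ 𝒳_n ∩ A} (Ṽ(x;𝒳_n) ∩ Ω)`. -/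
def vorEst {d : ℕ} {Ωp : Type*} (X : ℕ → Ωp → EucSp d) (A : Set (EucSp d))
    (n : ℕ) (ω : Ωp) : Set (EucSp d) :=
  ⋃ i ∈ Set.Iio n, ⋃ (_ : X i ω ∈ A), vorCell (X i ω) (sample X n ω) ∩ unitCube d


namespace VorAux

/-- half-open grid box -/
def qbox {d : ℕ} (m : ℕ) (j : Fin d → Fin m) : Set (EucSp d) :=
  {x | ∀ i, x i ∈ Set.Ico ((j i : ℝ) / m) (((j i : ℝ) + 1) / m)}

def obox {d : ℕ} (m : ℕ) (j : Fin d → Fin m) : Set (EucSp d) :=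
  {x | ∀ i, x i ∈ Set.Ioo ((j i : ℝ) / m) (((j i : ℝ) + 1) / m)}

lemma measurableSet_qbox {d m : ℕ} (j : Fin d → Fin m) : MeasurableSet (qbox m j) := by
  have : qbox m j = ⋂ i, (fun x : EucSp d => x i) ⁻¹'
      Set.Ico ((j i : ℝ) / m) (((j i : ℝ) + 1) / m) := by
    ext x; simp [qbox]
  rw [this]
  exact MeasurableSet.iInter fun i => (by fun_prop : Measurable fun x : EucSp d => x i)
    measurableSet_Ico

lemma measurableSet_obox {d m : ℕ} (j : Fin d → Fin m) : MeasurableSet (obox m j) := by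
  have : obox m j = ⋂ i, (fun x : EucSp d => x i) ⁻¹'
      Set.Ioo ((j i : ℝ) / m) (((j i : ℝ) + 1) / m) := by
    ext x; simp [obox]
  rw [this]
  exact MeasurableSet.iInter fun i => (by fun_prop : Measurable fun x : EucSp d => x i)
    measurableSet_Ioo

lemma volume_qbox {d m : ℕ} (j : Fin d → Fin m) :
    volume (qbox m j) = ENNReal.ofReal (1 / (m : ℝ) ^ d) := by
  have : qbox m j = (@WithLp.ofLp 2 (Fin d → ℝ)) ⁻¹' (Set.univ.pi fun i =>
      Set.Ico ((j i : ℝ) / m) (((j i : ℝ) + 1) / m)) := by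
    ext x; simp [qbox]
  rw [this, (PiLp.volume_preserving_ofLp (Fin d)).measure_preimage
    (MeasurableSet.univ_pi fun i => measurableSet_Ico).nullMeasurableSet, Real.volume_pi_Ico]
  simp [← sub_div]
  rw [← inv_pow, ENNReal.ofReal_pow (by positivity)]

lemma volume_obox {d m : ℕ} (j : Fin d → Fin m) :
    volume (obox m j) = ENNReal.ofReal (1 / (m : ℝ) ^ d) := by
  have : obox m j = (@WithLp.ofLp 2 (Fin d → ℝ)) ⁻¹' (Set.univ.pi fun i =>
      Set.Ioo ((j i : ℝ) / m) (((j i : ℝ) + 1) / m)) := by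
    ext x; simp [obox]
  rw [this, (PiLp.volume_preserving_ofLp (Fin d)).measure_preimage
    (MeasurableSet.univ_pi fun i => measurableSet_Ioo).nullMeasurableSet, Real.volume_pi_Ioo]
  simp [← sub_div]
  rw [← inv_pow, ENNReal.ofReal_pow (by positivity)]

lemma obox_subset_qbox {d m : ℕ} (j : Fin d → Fin m) : obox m j ⊆ qbox m j :=
  fun _ hx i => ⟨(hx i).1.le, (hx i).2⟩

lemma obox_subset_cube {d m : ℕ} (j : Fin d → Fin m) : obox m j ⊆ unitCube d := by
  intro x hx i
  have h1 := (hx i).1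
  have h2 := (hx i).2
  have hm : 0 < m := (Nat.zero_le _).trans_lt (j i).2
  have hm' : (0 : ℝ) < m := by exact_mod_cast hm
  have h3 : ((j i : ℕ) : ℝ) + 1 ≤ m := by exact_mod_cast (j i).2
  refine ⟨lt_of_le_of_lt (by positivity) h1, lt_of_lt_of_le h2 ?_⟩
  rw [div_le_one hm']
  exact h3

lemma qbox_disjoint {d m : ℕ} {j j' : Fin d → Fin m} (h : j ≠ j') :
    Disjoint (qbox m j) (qbox m j') := by
  rw [Set.disjoint_left]
  intro x hx hx'
  apply h
  ext i
  have hm : 0 < m := (Nat.zero_le _).trans_lt (j i).2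
  have hm' : (0 : ℝ) < m := by exact_mod_cast hm
  have h1 := hx i
  have h2 := hx' i
  simp only [Set.mem_Ico, div_le_iff₀ hm', lt_div_iff₀ hm'] at h1 h2
  have a : ((j i : ℕ) : ℝ) < (j' i : ℕ) + 1 := by linarith
  have b : ((j' i : ℕ) : ℝ) < (j i : ℕ) + 1 := by linarith
  norm_cast at a b
  omega

lemma exists_qbox {d m : ℕ} (hm : 0 < m) {x : EucSp d} (hx : x ∈ unitCube d) :
    ∃ j : Fin d → Fin m, x ∈ qbox m j := by
  have hm' : (0 : ℝ) < m := by exact_mod_cast hm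
  have h0 : ∀ i, 0 ≤ x i * m := fun i => mul_nonneg (hx i).1.le hm'.le
  refine ⟨fun i => ⟨⌊x i * m⌋₊, ?_⟩, fun i => ?_⟩
  · rw [Nat.floor_lt (h0 i)]
    have := (hx i).2
    nlinarith
  · simp only [Set.mem_Ico, div_le_iff₀ hm', lt_div_iff₀ hm']
    exact ⟨Nat.floor_le (h0 i), Nat.lt_floor_add_one _⟩

lemma dist_le_of_qbox {d m : ℕ} {j : Fin d → Fin m} {x y : EucSp d}
    (hx : x ∈ qbox m j) (hy : y ∈ qbox m j) : dist x y ≤ √d / m := by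
  rw [EuclideanSpace.dist_eq]
  have : ∑ i, dist (x i) (y i) ^ 2 ≤ (√d / m) ^ 2 := by
    calc ∑ i, dist (x i) (y i) ^ 2 ≤ ∑ i : Fin d, (1 / (m : ℝ)) ^ 2 := by
          refine Finset.sum_le_sum fun i _ => ?_
          have h1 := hx i
          have h2 := hy i
          simp only [Set.mem_Ico, add_div] at h1 h2
          have : dist (x i) (y i) ≤ 1 / m := by
            rw [Real.dist_eq, abs_le]
            constructor <;> linarith
          gcongr
      _ = (√d / m) ^ 2 := by
          rw [div_pow (√(d : ℝ)), Real.sq_sqrt (by positivity)]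
          simp
          field_simp
  exact (Real.sqrt_le_sqrt this).trans (Real.sqrt_sq (by positivity)).le

/-- the event that the first `n` points avoid `S` -/
def avoid {d : ℕ} {Ωp : Type*} (X : ℕ → Ωp → EucSp d) (n : ℕ) (S : Set (EucSp d)) : Set Ωp :=
  {ω | ∀ i < n, X i ω ∉ S}

set_option linter.unusedSectionVars false

variable {d : ℕ} {Ωp : Type*} [MeasurableSpace Ωp]

lemma avoid_eq (X : ℕ → Ωp → EucSp d) (n : ℕ) (S : Set (EucSp d)) :
    avoid X n S = ⋂ i ∈ Finset.range n, X i ⁻¹' Sᶜ := by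
  ext ω; simp [avoid]

lemma measurableSet_avoid {X : ℕ → Ωp → EucSp d} (hX : ∀ i, Measurable (X i)) (n : ℕ)
    {S : Set (EucSp d)} (hS : MeasurableSet S) : MeasurableSet (avoid X n S) := by
  rw [avoid_eq]
  exact Finset.measurableSet_biInter _ fun i _ => hX i hS.compl

lemma prob_avoid {P : Measure Ωp} [IsProbabilityMeasure P] {μ : Measure (EucSp d)}
    [IsProbabilityMeasure μ]
    {X : ℕ → Ωp → EucSp d} (hX : ∀ i, Measurable (X i)) (hind : iIndepFun X P)
    (hlaw : ∀ i, Measure.map (X i) P = μ) (n : ℕ)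
    {S : Set (EucSp d)} (hS : MeasurableSet S) :
    P.real (avoid X n S) = (1 - μ.real S) ^ n := by
  rw [avoid_eq, measureReal_def,
    hind.measure_inter_preimage_eq_mul (Finset.range n) (sets := fun _ => Sᶜ)
      (fun i _ => hS.compl)]
  have : ∀ i, P (X i ⁻¹' Sᶜ) = μ Sᶜ := fun i => by
    rw [← hlaw i, Measure.map_apply (hX i) hS.compl]
  simp only [this, Finset.prod_const, Finset.card_range, ENNReal.toReal_pow]
  rw [← measureReal_def, probReal_compl_eq_one_sub hS]

/-- number of empty boxes -/
def emptyCount (X : ℕ → Ωp → EucSp d) (n m : ℕ) (ω : Ωp) : ℝ :=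
  ∑ j : Fin d → Fin m, (avoid X n (qbox m j)).indicator (fun _ => (1 : ℝ)) ω

lemma memLp_ind {P : Measure Ωp} [IsProbabilityMeasure P] {X : ℕ → Ωp → EucSp d}
    (hX : ∀ i, Measurable (X i)) (n m : ℕ) (j : Fin d → Fin m) :
    MemLp ((avoid X n (qbox m j)).indicator (fun _ => (1 : ℝ))) 2 P :=
  memLp_indicator_const 2 (measurableSet_avoid hX n (measurableSet_qbox j)) 1
    (Or.inr (measure_ne_top _ _))

lemma var_emptyCount {P : Measure Ωp} [IsProbabilityMeasure P] {μ : Measure (EucSp d)}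
    [IsProbabilityMeasure μ]
    {X : ℕ → Ωp → EucSp d} (hX : ∀ i, Measurable (X i)) (hind : iIndepFun X P)
    (hlaw : ∀ i, Measure.map (X i) P = μ) (n m : ℕ) :
    Var[emptyCount X n m; P] ≤ (m : ℝ) ^ d := by
  unfold emptyCount
  rw [variance_fun_sum (fun j => memLp_ind hX n m j)]
  have key : ∀ j j' : Fin d → Fin m,
      cov[(avoid X n (qbox m j)).indicator (fun _ => (1 : ℝ)),
        (avoid X n (qbox m j')).indicator (fun _ => (1 : ℝ)); P] ≤ if j = j' then 1 else 0 := by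
    intro j j'
    have hm1 := measurableSet_avoid hX n (measurableSet_qbox j)
    have hm2 := measurableSet_avoid hX n (measurableSet_qbox j')
    rw [covariance_eq_sub (memLp_ind hX n m j) (memLp_ind hX n m j')]
    have e1 : ((avoid X n (qbox m j)).indicator (fun _ => (1 : ℝ)) *
        (avoid X n (qbox m j')).indicator (fun _ => (1 : ℝ)))
        = (avoid X n (qbox m j) ∩ avoid X n (qbox m j')).indicator (fun _ => (1 : ℝ)) := by
      ext ω
      by_cases h1 : ω ∈ avoid X n (qbox m j) <;> by_cases h2 : ω ∈ avoid X n (qbox m j') <;>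
        simp [h1, h2]
    rw [e1, integral_indicator_const _ (hm1.inter hm2), integral_indicator_const _ hm1,
      integral_indicator_const _ hm2]
    simp only [smul_eq_mul, mul_one]
    split_ifs with h
    · have a : P.real (avoid X n (qbox m j) ∩ avoid X n (qbox m j')) ≤ 1 := measureReal_le_one
      have b : 0 ≤ P.real (avoid X n (qbox m j)) * P.real (avoid X n (qbox m j')) := by positivity
      linarith
    · have e2 : avoid X n (qbox m j) ∩ avoid X n (qbox m j')
          = avoid X n (qbox m j ∪ qbox m j') := by
        ext ω
        simp only [avoid, Set.mem_inter_iff, Set.mem_ofPred_eq, Set.mem_union, not_or]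
        exact ⟨fun h i hi => ⟨h.1 i hi, h.2 i hi⟩,
          fun h => ⟨fun i hi => (h i hi).1, fun i hi => (h i hi).2⟩⟩
      have hu : μ.real (qbox m j ∪ qbox m j') = μ.real (qbox m j) + μ.real (qbox m j') :=
        measureReal_union (qbox_disjoint h) (measurableSet_qbox j')
      have hle : μ.real (qbox m j ∪ qbox m j') ≤ 1 := measureReal_le_one
      rw [e2, prob_avoid hX hind hlaw n ((measurableSet_qbox j).union (measurableSet_qbox j')),
        prob_avoid hX hind hlaw n (measurableSet_qbox j),
        prob_avoid hX hind hlaw n (measurableSet_qbox j'), ← mul_pow, sub_nonpos]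
      rw [hu] at hle ⊢
      have p1 : 0 ≤ μ.real (qbox m j) := by positivity
      have p2 : 0 ≤ μ.real (qbox m j') := by positivity
      apply pow_le_pow_left₀ (by linarith)
      nlinarith
  calc _ ≤ ∑ j : Fin d → Fin m, ∑ j' : Fin d → Fin m, (if j = j' then (1 : ℝ) else 0) :=
        Finset.sum_le_sum fun j _ => Finset.sum_le_sum fun j' _ => key j j'
    _ = (m : ℝ) ^ d := by simp

lemma mean_emptyCount {P : Measure Ωp} [IsProbabilityMeasure P] {μ : Measure (EucSp d)}
    [IsProbabilityMeasure μ]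
    {X : ℕ → Ωp → EucSp d} (hX : ∀ i, Measurable (X i)) (hind : iIndepFun X P)
    (hlaw : ∀ i, Measure.map (X i) P = μ) {c : ℝ} (m K : ℕ) (hm : 0 < m)
    (hc : ∀ j : Fin d → Fin m, c / (m : ℝ) ^ d ≤ μ.real (qbox m j)) :
    P[emptyCount X (K * m ^ d) m] ≤ Real.exp (- (c * K)) * (m : ℝ) ^ d := by
  unfold emptyCount
  rw [integral_finsetSum _ fun j _ => (memLp_ind hX _ m j).integrable (by norm_num)]
  have key : ∀ j : Fin d → Fin m,
      ∫ ω, (avoid X (K * m ^ d) (qbox m j)).indicator (fun _ => (1 : ℝ)) ω ∂P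
        ≤ Real.exp (- (c * K)) := by
    intro j
    rw [integral_indicator_const _ (measurableSet_avoid hX _ (measurableSet_qbox j)),
      prob_avoid hX hind hlaw _ (measurableSet_qbox j)]
    simp only [smul_eq_mul, mul_one]
    have hle : μ.real (qbox m j) ≤ 1 := measureReal_le_one
    have hm' : (0 : ℝ) < m := by exact_mod_cast hm
    calc (1 - μ.real (qbox m j)) ^ (K * m ^ d)
        ≤ (Real.exp (- (c / (m : ℝ) ^ d))) ^ (K * m ^ d) := by
          apply pow_le_pow_left₀ (by linarith)
          have := Real.add_one_le_exp (- (c / (m : ℝ) ^ d))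
          linarith [hc j]
      _ = Real.exp (- (c * K)) := by
          rw [← Real.exp_nat_mul]
          congr 1
          push_cast
          field_simp
  calc _ ≤ ∑ j : Fin d → Fin m, Real.exp (- (c * K)) := Finset.sum_le_sum fun j _ => key j
    _ = _ := by simp; ring

lemma ae_emptyCount (hd : 1 ≤ d) {P : Measure Ωp} [IsProbabilityMeasure P] {μ : Measure (EucSp d)}
    [IsProbabilityMeasure μ]
    {X : ℕ → Ωp → EucSp d} (hX : ∀ i, Measurable (X i)) (hind : iIndepFun X P)
    (hlaw : ∀ i, Measure.map (X i) P = μ) {c : ℝ} (K : ℕ)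
    (hc : ∀ (m : ℕ) (j : Fin d → Fin m), c / (m : ℝ) ^ d ≤ μ.real (qbox m j))
    {δ : ℝ} (hδ : 0 < δ) :
    ∀ᵐ ω ∂P, ∀ᶠ k : ℕ in atTop, emptyCount X (K * (2 ^ k) ^ d) (2 ^ k) ω
      ≤ (Real.exp (- (c * K)) + δ) * ((2 ^ k : ℕ) : ℝ) ^ d := by
  set Z : ℕ → Ωp → ℝ := fun k => emptyCount X (K * (2 ^ k) ^ d) (2 ^ k) with hZ
  have hmem : ∀ k, MemLp (Z k) 2 P := fun k =>
    memLp_finsetSum _ fun j _ => memLp_ind hX _ _ j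
  have hpos : ∀ k : ℕ, (0 : ℝ) < ((2 ^ k : ℕ) : ℝ) ^ d := fun k => by positivity
  have hb : ∀ k, P {ω | δ * ((2 ^ k : ℕ) : ℝ) ^ d ≤ |Z k ω - P[Z k]|}
      ≤ ENNReal.ofReal ((1 / δ ^ 2) * (1 / 2) ^ k) := by
    intro k
    refine (meas_ge_le_variance_div_sq (hmem k) (mul_pos hδ (hpos k))).trans ?_
    apply ENNReal.ofReal_le_ofReal
    have hv := var_emptyCount hX hind hlaw (K * (2 ^ k) ^ d) (2 ^ k)
    calc Var[Z k; P] / (δ * ((2 ^ k : ℕ) : ℝ) ^ d) ^ 2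
        ≤ ((2 ^ k : ℕ) : ℝ) ^ d / (δ * ((2 ^ k : ℕ) : ℝ) ^ d) ^ 2 := by gcongr
      _ = (1 / δ ^ 2) * (1 / ((2 ^ k : ℕ) : ℝ) ^ d) := by
          have := (hpos k).ne'
          field_simp
      _ ≤ (1 / δ ^ 2) * (1 / 2) ^ k := by
          rw [one_div_pow]
          gcongr
          push_cast
          exact le_self_pow₀ (one_le_pow₀ (by norm_num)) (by omega)
  have hs : ∑' k, P {ω | δ * ((2 ^ k : ℕ) : ℝ) ^ d ≤ |Z k ω - P[Z k]|} ≠ ⊤ := by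
    refine ne_top_of_le_ne_top ?_ (ENNReal.tsum_le_tsum hb)
    have : Summable fun k : ℕ => (1 / δ ^ 2) * (1 / 2 : ℝ) ^ k :=
      summable_geometric_two.mul_left _
    exact this.tsum_ofReal_ne_top
  filter_upwards [ae_eventually_notMem hs] with ω hω
  filter_upwards [hω] with k hk
  simp only [not_le] at hk
  have hmean := mean_emptyCount hX hind hlaw (2 ^ k) K (by positivity) (hc (2 ^ k))
  have := (abs_lt.1 hk).2
  change Z k ω ≤ _
  change P[Z k] ≤ _ at hmean
  linarith

lemma ae_count {P : Measure Ωp} [IsProbabilityMeasure P] {μ : Measure (EucSp d)}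
    {X : ℕ → Ωp → EucSp d} (hX : ∀ i, Measurable (X i)) (hind : iIndepFun X P)
    (hlaw : ∀ i, Measure.map (X i) P = μ) {R : Set (EucSp d)} (hR : MeasurableSet R) :
    ∀ᵐ ω ∂P, Tendsto (fun n : ℕ => (∑ i ∈ Finset.range n, R.indicator (fun _ => (1 : ℝ)) (X i ω)) / n)
      atTop (𝓝 (μ.real R)) := by
  have hmi : Measurable (R.indicator (fun _ => (1 : ℝ))) := measurable_const.indicator hR
  have h := strong_law_ae_real (μ := P) (fun i ω => R.indicator (fun _ => (1 : ℝ)) (X i ω)) ?_ ?_ ?_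
  · have e : ∫ ω, R.indicator (fun _ => (1 : ℝ)) (X 0 ω) ∂P = μ.real R := by
      rw [← integral_map (hX 0).aemeasurable hmi.aestronglyMeasurable, hlaw 0,
        integral_indicator_const _ hR]
      simp
    rw [e] at h
    exact h
  · have : (fun ω => R.indicator (fun _ => (1 : ℝ)) (X 0 ω))
        = (X 0 ⁻¹' R).indicator (fun _ => (1 : ℝ)) := by
      ext ω
      by_cases h : X 0 ω ∈ R
      · rw [Set.indicator_of_mem h, Set.indicator_of_mem (show ω ∈ X 0 ⁻¹' R from h)]
      · rw [Set.indicator_of_notMem h, Set.indicator_of_notMem (show ω ∉ X 0 ⁻¹' R from h)]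
    rw [this]
    exact (integrable_const _).indicator (hX 0 hR)
  · intro i j hij
    exact (hind.indepFun hij).comp hmi hmi
  · intro i
    have : IdentDistrib (X i) (X 0) P P :=
      ⟨(hX i).aemeasurable, (hX 0).aemeasurable, by rw [hlaw, hlaw]⟩
    exact this.comp hmi

/-- covering set for the symmetric difference -/
def cover (X : ℕ → Ωp → EucSp d) (R : Set (EucSp d)) (n₀ n m : ℕ) (ω : Ωp) : Set (EucSp d) :=
  (⋃ j : Fin d → Fin m, ⋃ (_ : ω ∈ avoid X n₀ (qbox m j)), qbox m j) ∪ (R ∩ unitCube d) ∪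
    ⋃ i ∈ Finset.range n, ⋃ (_ : X i ω ∈ R), Metric.closedBall (X i ω) (√d / m)

lemma sdiff_subset_cover (X : ℕ → Ωp → EucSp d) {A K L : Set (EucSp d)} (hK : K ⊆ A)
    (hL : L ⊆ Aᶜ) {n₀ n m : ℕ} (hn : n₀ ≤ n) (hm : 0 < m) (ω : Ωp)
    (hsep : ∀ x ∈ K, ∀ y ∈ L, √d / m < dist x y) {y : EucSp d} (hy : y ∈ unitCube d)
    (h : (y ∈ vorEst X A n ω ∧ y ∉ A) ∨ (y ∈ A ∧ y ∉ vorEst X A n ω)) :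
    y ∈ cover X (K ∪ L)ᶜ n₀ n m ω := by
  by_contra hcon
  simp only [cover, Set.mem_union, Set.mem_iUnion, not_or, not_exists, Set.mem_inter_iff,
    not_and] at hcon
  obtain ⟨⟨h1, h2⟩, h3⟩ := hcon
  have hyR : y ∈ K ∪ L := by
    by_contra hh
    exact h2 hh hy
  obtain ⟨j, hj⟩ := exists_qbox hm hy
  have hav : ω ∉ avoid X n₀ (qbox m j) := fun hh => h1 j hh hj
  have : ∃ i < n₀, X i ω ∈ qbox m j := by
    by_contra hh
    push Not at hh
    exact hav hh
  obtain ⟨i₀, hi₀, hi₀'⟩ := this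
  have hi₀n : i₀ < n := hi₀.trans_le hn
  have hd0 : dist y (X i₀ ω) ≤ √d / m := dist_le_of_qbox hj hi₀'
  have fin : ∀ i < n, (∀ i' < n, dist y (X i ω) ≤ dist y (X i' ω)) →
      ¬ ((X i ω ∈ A ∧ y ∉ A) ∨ (X i ω ∉ A ∧ y ∈ A)) := by
    intro i hi hmin hh
    have hdi : dist y (X i ω) ≤ √d / m := (hmin i₀ hi₀n).trans hd0
    have hxR : X i ω ∈ K ∪ L := by
      by_contra hc
      exact h3 i (Finset.mem_range.2 hi) hc (Metric.mem_closedBall.2 hdi)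
    rcases hh with ⟨ha, hb⟩ | ⟨ha, hb⟩
    · have hxK : X i ω ∈ K := hxR.resolve_right fun hc => hL hc ha
      have hyL : y ∈ L := hyR.resolve_left fun hc => hb (hK hc)
      have := hsep _ hxK _ hyL
      rw [dist_comm] at this
      linarith
    · have hxL : X i ω ∈ L := hxR.resolve_left fun hc => ha (hK hc)
      have hyK : y ∈ K := hyR.resolve_right fun hc => hL hc hb
      have := hsep _ hyK _ hxL
      linarith
  rcases h with ⟨ha, hb⟩ | ⟨ha, hb⟩
  · simp only [vorEst, Set.mem_iUnion] at ha
    obtain ⟨i, hi, hiA, hcell, -⟩ := ha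
    exact fin i hi (fun i' hi' => hcell _ ⟨i', hi', rfl⟩) (Or.inl ⟨hiA, hb⟩)
  · obtain ⟨i, hi, hmin⟩ := Finset.exists_min_image (Finset.range n) (fun i => dist y (X i ω))
      ⟨i₀, Finset.mem_range.2 hi₀n⟩
    rw [Finset.mem_range] at hi
    have hmin' : ∀ i' < n, dist y (X i ω) ≤ dist y (X i' ω) :=
      fun i' hi' => hmin i' (Finset.mem_range.2 hi')
    refine fin i hi hmin' (Or.inr ⟨fun hiA => hb ?_, ha⟩)
    simp only [vorEst, Set.mem_iUnion]
    refine ⟨i, hi, hiA, ?_, hy⟩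
    rintro z ⟨i', hi', rfl⟩
    exact hmin' i' hi'

lemma volume_cover_le (X : ℕ → Ωp → EucSp d) (R : Set (EucSp d)) (n₀ n m : ℕ) (ω : Ωp) :
    volume (cover X R n₀ n m ω) ≤
      ENNReal.ofReal (emptyCount X n₀ m ω * (1 / (m : ℝ) ^ d)) + volume (R ∩ unitCube d) +
      ENNReal.ofReal ((∑ i ∈ Finset.range n, R.indicator (fun _ => (1 : ℝ)) (X i ω)) *
        ((√d / m) ^ d * volume.real (Metric.closedBall (0 : EucSp d) 1))) := by
  refine (measure_union_le _ _).trans (add_le_add ((measure_union_le _ _).trans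
    (add_le_add ?_ le_rfl)) ?_)
  · refine (measure_iUnion_fintype_le _ _).trans ?_
    rw [emptyCount, Finset.sum_mul, ENNReal.ofReal_sum_of_nonneg]
    · refine Finset.sum_le_sum fun j _ => ?_
      by_cases h : ω ∈ avoid X n₀ (qbox m j)
      · simp [h, volume_qbox]
      · simp [h]
    · intro j _
      exact mul_nonneg (Set.indicator_nonneg (fun _ _ => zero_le_one) _) (by positivity)
  · refine (measure_biUnion_finset_le _ _).trans ?_
    rw [Finset.sum_mul, ENNReal.ofReal_sum_of_nonneg]
    · refine Finset.sum_le_sum fun i _ => ?_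
      by_cases h : X i ω ∈ R
      · simp only [h, Set.iUnion_true, Set.indicator_of_mem, one_mul]
        rw [Measure.addHaar_closedBall' _ _ (by positivity), ENNReal.ofReal_mul (by positivity),
          measureReal_def, ENNReal.ofReal_toReal measure_closedBall_lt_top.ne]
        simp
      · simp [h]
    · intro j _
      exact mul_nonneg (Set.indicator_nonneg (fun _ _ => zero_le_one) _) (by positivity)

lemma unitCube_eq : unitCube d = obox 1 (fun _ => (0 : Fin 1)) := by
  ext x; simp [unitCube, obox]

lemma exists_sep {μ : Measure (EucSp d)} [IsProbabilityMeasure μ] {A : Set (EucSp d)}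
    (hA : MeasurableSet A) {ε : ℝ} (hε : 0 < ε) :
    ∃ K L : Set (EucSp d), K ⊆ A ∧ L ⊆ Aᶜ ∧ IsCompact K ∧ IsCompact L ∧
      μ.real (K ∪ L)ᶜ ≤ ε ∧ volume ((K ∪ L)ᶜ ∩ unitCube d) ≤ ENNReal.ofReal ε := by
  have hfin : volume (unitCube d) ≠ ⊤ := by
    rw [unitCube_eq, volume_obox]; exact ENNReal.ofReal_ne_top
  have : IsFiniteMeasure (volume.restrict (unitCube d)) :=
    ⟨by rw [Measure.restrict_apply_univ]; exact hfin.lt_top⟩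
  set ν := μ + volume.restrict (unitCube d) with hν
  have hε2 : ENNReal.ofReal (ε / 2) ≠ 0 := by
    rw [Ne, ENNReal.ofReal_eq_zero]; linarith
  obtain ⟨K, hKA, hK, hK'⟩ := hA.exists_isCompact_sdiff_lt (measure_ne_top ν A) hε2
  obtain ⟨L, hLA, hL, hL'⟩ := hA.compl.exists_isCompact_sdiff_lt (measure_ne_top ν Aᶜ) hε2
  have hb : ν (K ∪ L)ᶜ ≤ ENNReal.ofReal ε := by
    calc ν (K ∪ L)ᶜ ≤ ν ((A \ K) ∪ (Aᶜ \ L)) := by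
          apply measure_mono
          intro x hx
          simp only [Set.mem_compl_iff, Set.mem_union, not_or] at hx
          by_cases h : x ∈ A
          · exact Or.inl ⟨h, hx.1⟩
          · exact Or.inr ⟨h, hx.2⟩
      _ ≤ ν (A \ K) + ν (Aᶜ \ L) := measure_union_le _ _
      _ ≤ ENNReal.ofReal (ε / 2) + ENNReal.ofReal (ε / 2) := add_le_add hK'.le hL'.le
      _ = ENNReal.ofReal ε := by
          rw [← ENNReal.ofReal_add (by linarith) (by linarith)]; congr 1; ring
  have hR : MeasurableSet (K ∪ L)ᶜ := (hK.measurableSet.union hL.measurableSet).compl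
  rw [hν, Measure.add_apply, Measure.restrict_apply hR] at hb
  refine ⟨K, L, hKA, hLA, hK, hL, ?_, le_add_self.trans hb⟩
  exact ENNReal.toReal_le_of_le_ofReal hε.le (le_self_add.trans hb)

lemma ae_cover (hd : 1 ≤ d) {P : Measure Ωp} [IsProbabilityMeasure P] {μ : Measure (EucSp d)}
    [IsProbabilityMeasure μ]
    {X : ℕ → Ωp → EucSp d} (hX : ∀ i, Measurable (X i)) (hind : iIndepFun X P)
    (hlaw : ∀ i, Measure.map (X i) P = μ) {c : ℝ} (hc0 : 0 < c)
    (hc : ∀ (m : ℕ) (j : Fin d → Fin m), c / (m : ℝ) ^ d ≤ μ.real (qbox m j))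
    {A : Set (EucSp d)} (hA : MeasurableSet A) {δ : ℝ} (hδ : 0 < δ) :
    ∀ᵐ ω ∂P, ∀ᶠ n in atTop, ∃ W : Set (EucSp d), volume W ≤ ENNReal.ofReal (5 * δ) ∧
      ∀ y ∈ unitCube d, (y ∈ vorEst X A n ω ∧ y ∉ A) ∨ (y ∈ A ∧ y ∉ vorEst X A n ω) → y ∈ W := by
  obtain ⟨K, hK0, hKδ⟩ : ∃ K : ℕ, 0 < K ∧ Real.exp (-(c * K)) ≤ δ := by
    have h1 : Tendsto (fun K : ℕ => Real.exp (-(c * K))) atTop (𝓝 0) :=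
      Real.tendsto_exp_neg_atTop_nhds_zero.comp
        (tendsto_natCast_atTop_atTop.const_mul_atTop hc0)
    obtain ⟨K, hK⟩ := ((h1.eventually (ge_mem_nhds hδ)).and (eventually_gt_atTop 0)).exists
    exact ⟨K, hK.2, hK.1⟩
  set v : ℝ := volume.real (Metric.closedBall (0 : EucSp d) 1) with hv
  have hv0 : 0 ≤ v := measureReal_nonneg
  set C : ℝ := (K : ℝ) * 2 ^ d * (√d ^ d * v) with hC
  have hC0 : 0 ≤ C := by positivity
  set ε : ℝ := δ / (C + 1) with hε
  have hε0 : 0 < ε := by positivity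
  have hεδ : ε ≤ δ := div_le_self hδ.le (by linarith)
  have hεC : ε * C ≤ δ := by
    rw [hε, div_mul_eq_mul_div, div_le_iff₀ (by linarith)]
    nlinarith
  obtain ⟨K₁, L₁, hK₁A, hL₁A, hK₁, hL₁, hμR, hvR⟩ := exists_sep (μ := μ) hA hε0
  have hdisj : Disjoint K₁ L₁ := Set.disjoint_left.2 fun x hx hx' => hL₁A hx' (hK₁A hx)
  obtain ⟨ρ, hρ, hsep⟩ := Metric.exists_pos_forall_lt_edist hK₁ hL₁.isClosed hdisj
  have hR : MeasurableSet (K₁ ∪ L₁)ᶜ := (hK₁.measurableSet.union hL₁.measurableSet).compl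
  set b : ℕ := 2 ^ d with hb
  have hb1 : 1 < b := Nat.one_lt_two_pow (by omega)
  have hlog : Tendsto (fun n : ℕ => Nat.log b (n / K)) atTop atTop := by
    rw [tendsto_atTop]
    intro B
    filter_upwards [eventually_ge_atTop (b ^ B * K)] with n hn
    exact Nat.le_log_of_pow_le hb1 ((Nat.le_div_iff_mul_le hK0).2 hn)
  have hr : ∀ᶠ k : ℕ in atTop, √d / ((2 ^ k : ℕ) : ℝ) < ρ := by
    have h1 : Tendsto (fun k : ℕ => √d / ((2 ^ k : ℕ) : ℝ)) atTop (𝓝 0) := by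
      apply Tendsto.const_div_atTop
      exact tendsto_natCast_atTop_atTop.comp (tendsto_pow_atTop_atTop_of_one_lt (by norm_num))
    exact h1.eventually (gt_mem_nhds (by exact_mod_cast hρ))
  filter_upwards [ae_emptyCount hd hX hind hlaw K hc hδ, ae_count hX hind hlaw hR] with ω h1 h2
  have h2' := h2.eventually (ge_mem_nhds (show μ.real (K₁ ∪ L₁)ᶜ < 2 * ε by linarith))
  filter_upwards [hlog.eventually h1, hlog.eventually hr, h2', eventually_ge_atTop K] with
    n e1 e2 e3 e4
  set k := Nat.log b (n / K) with hk
  have hnK : n / K ≠ 0 := (Nat.div_pos e4 hK0).ne'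
  have hn0 : (0 : ℝ) < n := by exact_mod_cast hK0.trans_le e4
  have hM : (2 ^ k) ^ d = b ^ k := by rw [hb, ← pow_mul, ← pow_mul, mul_comm]
  have hlow : K * (2 ^ k) ^ d ≤ n := by
    rw [hM, mul_comm]
    exact (Nat.le_div_iff_mul_le hK0).1 (Nat.pow_log_le_self b hnK)
  have hup : n < b ^ (k + 1) * K :=
    (Nat.div_lt_iff_lt_mul hK0).1 (Nat.lt_pow_succ_log_self hb1 _)
  refine ⟨cover X (K₁ ∪ L₁)ᶜ (K * (2 ^ k) ^ d) n (2 ^ k) ω, ?_, fun y hy h =>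
    sdiff_subset_cover X hK₁A hL₁A hlow (by positivity) ω ?_ hy h⟩
  · refine (volume_cover_le _ _ _ _ _ _).trans ?_
    set M : ℝ := ((2 ^ k : ℕ) : ℝ) ^ d with hMdef
    have hM0 : 0 < M := by positivity
    have hupR : (n : ℝ) ≤ K * 2 ^ d * M := by
      have : n ≤ K * 2 ^ d * (2 ^ k) ^ d := by
        rw [hM, ← hb]; rw [pow_succ] at hup; nlinarith
      rw [hMdef]
      exact_mod_cast this
    have t1 : emptyCount X (K * (2 ^ k) ^ d) (2 ^ k) ω * (1 / M) ≤ 2 * δ := by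
      rw [mul_one_div, div_le_iff₀ hM0]
      refine e1.trans ?_
      gcongr
      linarith
    set N : ℝ := ∑ i ∈ Finset.range n, (K₁ ∪ L₁)ᶜ.indicator (fun _ => (1 : ℝ)) (X i ω) with hN
    have hN0 : 0 ≤ N := Finset.sum_nonneg fun i _ =>
      Set.indicator_nonneg (fun _ _ => zero_le_one) _
    have t2 : N * ((√d / ((2 ^ k : ℕ) : ℝ)) ^ d * v) ≤ 2 * δ := by
      have hN1 : N ≤ 2 * ε * n := by
        rwa [div_le_iff₀ hn0] at e3
      rw [div_pow, ← hMdef]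
      calc N * (√d ^ d / M * v) ≤ (2 * ε * (K * 2 ^ d * M)) * (√d ^ d / M * v) := by
            gcongr
            exact hN1.trans (by gcongr)
        _ = 2 * (ε * C) := by rw [hC]; field_simp
        _ ≤ 2 * δ := by linarith
    calc _ ≤ ENNReal.ofReal (2 * δ) + ENNReal.ofReal δ + ENNReal.ofReal (2 * δ) :=
          add_le_add (add_le_add (ENNReal.ofReal_le_ofReal t1)
            (hvR.trans (ENNReal.ofReal_le_ofReal hεδ))) (ENNReal.ofReal_le_ofReal t2)
      _ = ENNReal.ofReal (5 * δ) := by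
          rw [← ENNReal.ofReal_add (by linarith) (by linarith),
            ← ENNReal.ofReal_add (by linarith) (by linarith)]
          congr 1; ring
  · intro x hx y hy
    have := hsep x hx y hy
    rw [edist_nndist, ENNReal.coe_lt_coe] at this
    have h' : (ρ : ℝ) < dist x y := by rw [← coe_nndist]; exact_mod_cast this
    exact e2.trans h'

end VorAux

/-- **Theorem 5.1 (first assertion).** Almost surely `|A_n| → |A|` as `n → ∞`. -/
theorem stmt0 {d : ℕ} (hd : 1 ≤ d)
    {Ωp : Type*} [MeasureSpace Ωp] [IsProbabilityMeasure (ℙ : Measure Ωp)]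
    (κ : EucSp d → ℝ) (hκmeas : Measurable κ)
    (hκ0 : ∀ x ∉ unitCube d, κ x = 0)
    (hκpos : ∃ c > 0, ∀ x ∈ unitCube d, c ≤ κ x)
    (X : ℕ → Ωp → EucSp d) (hXmeas : ∀ i, Measurable (X i))
    (hiid : iIndepFun X ℙ)
    (hlaw : ∀ i, Measure.map (X i) ℙ
      = volume.withDensity fun x => ENNReal.ofReal (κ x))
    (A : Set (EucSp d)) (hA : MeasurableSet A) (hAΩ : A ⊆ unitCube d) :
    ∀ᵐ ω ∂ℙ, Tendsto (fun n => (volume (vorEst X A n ω)).toReal) atTop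
      (𝓝 (volume A).toReal) := by
  obtain ⟨c, hc0, hcκ⟩ := hκpos
  set μ : Measure (EucSp d) := volume.withDensity fun x => ENNReal.ofReal (κ x) with hμ
  have hprob : IsProbabilityMeasure μ := by
    rw [← hlaw 0]
    exact Measure.isProbabilityMeasure_map (hXmeas 0).aemeasurable
  have hc : ∀ (m : ℕ) (j : Fin d → Fin m), c / (m : ℝ) ^ d ≤ μ.real (VorAux.qbox m j) := by
    intro m j
    have h1 : ENNReal.ofReal (c / (m : ℝ) ^ d) ≤ μ (VorAux.qbox m j) := by
      calc ENNReal.ofReal (c / (m : ℝ) ^ d)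
          = ∫⁻ _ in VorAux.obox m j, ENNReal.ofReal c := by
            rw [setLIntegral_const, VorAux.volume_obox, ← ENNReal.ofReal_mul hc0.le, mul_one_div]
        _ ≤ ∫⁻ x in VorAux.obox m j, ENNReal.ofReal (κ x) :=
            setLIntegral_mono' (VorAux.measurableSet_obox j) fun x hx =>
              ENNReal.ofReal_le_ofReal (hcκ x (VorAux.obox_subset_cube j hx))
        _ = μ (VorAux.obox m j) := by
            rw [hμ, withDensity_apply _ (VorAux.measurableSet_obox j)]
        _ ≤ μ (VorAux.qbox m j) := measure_mono (VorAux.obox_subset_qbox j)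
    exact (ENNReal.ofReal_le_iff_le_toReal (measure_ne_top _ _)).1 h1
  have hfin : volume (unitCube d) ≠ ⊤ := by
    rw [VorAux.unitCube_eq, VorAux.volume_obox]; exact ENNReal.ofReal_ne_top
  have hAfin : volume A ≠ ⊤ := measure_ne_top_of_subset hAΩ hfin
  have hmain : ∀ᵐ ω ∂(ℙ : Measure Ωp), ∀ l : ℕ, ∀ᶠ n in atTop, ∃ W : Set (EucSp d),
      volume W ≤ ENNReal.ofReal (5 * (1 / ((l : ℝ) + 1))) ∧
      ∀ y ∈ unitCube d, (y ∈ vorEst X A n ω ∧ y ∉ A) ∨ (y ∈ A ∧ y ∉ vorEst X A n ω) → y ∈ W :=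
    ae_all_iff.2 fun l => VorAux.ae_cover hd hXmeas hiid hlaw hc0 hc hA (by positivity)
  filter_upwards [hmain] with ω hω
  rw [Metric.tendsto_atTop']
  intro η hη
  obtain ⟨l, hl⟩ := exists_nat_one_div_lt (show (0 : ℝ) < η / 5 by positivity)
  obtain ⟨n₀, hn₀⟩ := eventually_atTop.1 (hω l)
  refine ⟨n₀, fun n hn => ?_⟩
  obtain ⟨W, hW, hsub⟩ := hn₀ n hn.le
  have hEsub : vorEst X A n ω ⊆ unitCube d := by
    intro y hy
    simp only [vorEst, Set.mem_iUnion] at hy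
    obtain ⟨i, hi, hiA, -, h⟩ := hy
    exact h
  have hEfin : volume (vorEst X A n ω) ≠ ⊤ := measure_ne_top_of_subset hEsub hfin
  have hWfin : volume W ≠ ⊤ := ne_top_of_le_ne_top ENNReal.ofReal_ne_top hW
  have hWr : volume.real W ≤ 5 * (1 / ((l : ℝ) + 1)) :=
    ENNReal.toReal_le_of_le_ofReal (by positivity) hW
  have u1 : volume.real (vorEst X A n ω) ≤ volume.real A + volume.real W := by
    refine (measureReal_mono ?_ (measure_union_lt_top hAfin.lt_top hWfin.lt_top).ne).trans
      (measureReal_union_le A W)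
    intro y hy
    by_cases h : y ∈ A
    · exact Or.inl h
    · exact Or.inr (hsub y (hEsub hy) (Or.inl ⟨hy, h⟩))
  have u2 : volume.real A ≤ volume.real (vorEst X A n ω) + volume.real W := by
    refine (measureReal_mono ?_ (measure_union_lt_top hEfin.lt_top hWfin.lt_top).ne).trans
      (measureReal_union_le _ W)
    intro y hy
    by_cases h : y ∈ vorEst X A n ω
    · exact Or.inl h
    · exact Or.inr (hsub y (hAΩ hy) (Or.inr ⟨hy, h⟩))
  change dist (volume.real (vorEst X A n ω)) (volume.real A) < η
  rw [Real.dist_eq, abs_lt]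
  constructor <;> linarith
end
end

section
/- Almost surely, |A Δ A_n| → 0 as n → ∞; that is, the Lebesgue measure of the symmetric difference between A and the Voronoi estimator A_n converges almost surely to zero. (This is the second assertion of Theorem 5.1.) -/
open MeasureTheory ProbabilityTheory Filter Topology
open scoped RealInnerProductSpace

noncomputable section

lemma measurableSet_unitCube (d : ℕ) : MeasurableSet (unitCube d) := by
  have : unitCube d = ⋂ i, (fun x : EucSp d => x i) ⁻¹' Set.Ioo (0 : ℝ) 1 := by
    ext x; simp [unitCube]
  rw [this]
  refine MeasurableSet.iInter fun i => ?_
  have : Measurable (fun x : EucSp d => x i) := by fun_prop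
  exact this measurableSet_Ioo

lemma law_lower {d : ℕ} (κ : EucSp d → ℝ) (c : ℝ)
    (hc : ∀ x ∈ unitCube d, c ≤ κ x) (D : Set (EucSp d)) (hD : MeasurableSet D)
    (hDΩ : D ⊆ unitCube d) :
    ENNReal.ofReal c * volume D ≤ (volume.withDensity fun x => ENNReal.ofReal (κ x)) D := by
  rw [withDensity_apply _ hD, ← setLIntegral_const]
  exact setLIntegral_mono' hD fun x hx => ENNReal.ofReal_le_ofReal (hc x (hDΩ hx))

/-- union bound over subsets of cells -/
lemma core_bound {d : ℕ}
    {Ωp : Type*} [MeasureSpace Ωp] [IsProbabilityMeasure (ℙ : Measure Ωp)]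
    (κ : EucSp d → ℝ) (c : ℝ) (hc0 : 0 < c)
    (hc : ∀ x ∈ unitCube d, c ≤ κ x)
    (X : ℕ → Ωp → EucSp d) (hXmeas : ∀ i, Measurable (X i))
    (hiid : iIndepFun X ℙ)
    (hlaw : ∀ i, Measure.map (X i) ℙ
      = volume.withDensity fun x => ENNReal.ofReal (κ x))
    {ι : Type*} [MeasurableSpace ι] [Countable ι] [MeasurableSingletonClass ι] [DecidableEq ι]
    (q : EucSp d → ι) (hq : Measurable q) (J : Finset ι) (hqJ : ∀ y ∈ unitCube d, q y ∈ J)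
    (n : ℕ) (δ : ℝ) (hδ : 0 < δ) :
    ℙ {ω | ENNReal.ofReal δ < volume {y | y ∈ unitCube d ∧ ∀ i < n, q (X i ω) ≠ q y}}
      ≤ ENNReal.ofReal (2 ^ J.card * Real.exp (- (c * δ) * n)) := by
  classical
  set T : Finset (Finset ι) := J.powerset.filter
    (fun S => ENNReal.ofReal δ < volume (unitCube d ∩ q ⁻¹' (S : Set ι))) with hT
  set D : Finset ι → Set (EucSp d) := fun S => unitCube d ∩ q ⁻¹' (S : Set ι) with hDdef
  have hDm : ∀ S, MeasurableSet (D S) := fun S =>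
    (measurableSet_unitCube d).inter (hq (Set.to_countable _).measurableSet)
  have hsub : {ω | ENNReal.ofReal δ < volume {y | y ∈ unitCube d ∧ ∀ i < n, q (X i ω) ≠ q y}}
      ⊆ ⋃ S ∈ T, ⋂ i ∈ Finset.range n, X i ⁻¹' (D S)ᶜ := by
    intro ω hω
    simp only [Set.mem_ofPred_eq] at hω
    simp only [Set.mem_iUnion]
    refine ⟨J.filter (fun j => ∀ i < n, q (X i ω) ≠ j), ?_, ?_⟩
    · simp only [hT, Finset.mem_filter, Finset.mem_powerset]
      refine ⟨Finset.filter_subset _ _, ?_⟩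
      convert hω using 3
      ext y
      simp only [Set.mem_inter_iff, Set.mem_preimage, Finset.mem_coe, Finset.mem_filter,
        Set.mem_ofPred_eq]
      constructor
      · rintro ⟨h1, h2, h3⟩; exact ⟨h1, h3⟩
      · rintro ⟨h1, h3⟩; exact ⟨h1, hqJ y h1, h3⟩
    · simp only [Set.mem_iInter, Finset.mem_range]
      intro i hi
      simp only [Set.mem_preimage, Set.mem_compl_iff, hDdef, Set.mem_inter_iff, Finset.mem_coe,
        Finset.mem_filter]
      rintro ⟨-, -, h⟩
      exact h i hi rfl
  have hterm : ∀ S ∈ T, ℙ (⋂ i ∈ Finset.range n, X i ⁻¹' (D S)ᶜ)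
      ≤ ENNReal.ofReal (Real.exp (- (c * δ) * n)) := by
    intro S hS
    rw [hiid.measure_inter_preimage_eq_mul (Finset.range n) (fun i _ => (hDm S).compl)]
    have hone : ∀ i ∈ Finset.range n, ℙ (X i ⁻¹' (D S)ᶜ)
        ≤ ENNReal.ofReal (Real.exp (-(c * δ))) := by
      intro i _
      have h1 : ENNReal.ofReal (c * δ) ≤ ℙ (X i ⁻¹' (D S)) := by
        rw [← Measure.map_apply (hXmeas i) (hDm S), hlaw i]
        refine le_trans ?_ (law_lower κ c hc (D S) (hDm S) Set.inter_subset_left)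
        rw [ENNReal.ofReal_mul hc0.le]
        gcongr
        exact (Finset.mem_filter.1 hS).2.le
      rw [Set.preimage_compl, prob_compl_eq_one_sub ((hXmeas i) (hDm S))]
      calc 1 - ℙ (X i ⁻¹' (D S)) ≤ 1 - ENNReal.ofReal (c * δ) := by gcongr
        _ = ENNReal.ofReal (1 - c * δ) := by
          rw [ENNReal.ofReal_sub _ (by positivity), ENNReal.ofReal_one]
        _ ≤ _ := by
          apply ENNReal.ofReal_le_ofReal
          have := Real.add_one_le_exp (-(c * δ))
          linarith
    refine (Finset.prod_le_prod' hone).trans ?_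
    rw [Finset.prod_const, Finset.card_range, ← ENNReal.ofReal_pow (Real.exp_pos _).le,
      ← Real.exp_nat_mul]
    apply le_of_eq; congr 2; ring
  calc _ ≤ ℙ (⋃ S ∈ T, ⋂ i ∈ Finset.range n, X i ⁻¹' (D S)ᶜ) := measure_mono hsub
    _ ≤ ∑ S ∈ T, ℙ (⋂ i ∈ Finset.range n, X i ⁻¹' (D S)ᶜ) := measure_biUnion_finset_le _ _
    _ ≤ ∑ S ∈ T, ENNReal.ofReal (Real.exp (- (c * δ) * n)) := Finset.sum_le_sum hterm
    _ = T.card * ENNReal.ofReal (Real.exp (- (c * δ) * n)) := by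
      rw [Finset.sum_const, nsmul_eq_mul]
    _ ≤ ENNReal.ofReal (2 ^ J.card) * ENNReal.ofReal (Real.exp (- (c * δ) * n)) := by
      gcongr
      have : T.card ≤ 2 ^ J.card := by
        rw [← Finset.card_powerset]; exact Finset.card_filter_le _ _
      have h2 : (T.card : ℝ) ≤ 2 ^ J.card := by exact_mod_cast this
      rw [← ENNReal.ofReal_natCast]
      exact ENNReal.ofReal_le_ofReal h2
    _ = _ := (ENNReal.ofReal_mul (by positivity)).symm

lemma dist_le_of_floor {d : ℕ} (hd : 1 ≤ d) (N : ℕ) (hN : 1 ≤ N) (y z : EucSp d)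
    (h : ∀ i, ⌊(N : ℝ) * y i⌋ = ⌊(N : ℝ) * z i⌋) : dist y z ≤ (d : ℝ) / N := by
  have hN0 : (0 : ℝ) < N := by exact_mod_cast hN
  have hd1 : (1 : ℝ) ≤ d := by exact_mod_cast hd
  rw [EuclideanSpace.dist_eq]
  apply Real.sqrt_le_iff.2
  refine ⟨by positivity, ?_⟩
  have h1 : ∀ i ∈ (Finset.univ : Finset (Fin d)), dist (y i) (z i) ^ 2 ≤ (1 / (N : ℝ)) ^ 2 := by
    intro i _
    have := Int.abs_sub_lt_one_of_floor_eq_floor (h i)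
    rw [← mul_sub, abs_mul, abs_of_pos hN0] at this
    rw [Real.dist_eq]
    gcongr
    rw [le_div_iff₀ hN0]; linarith
  refine (Finset.sum_le_sum h1).trans ?_
  rw [Finset.sum_const, nsmul_eq_mul, Finset.card_univ, Fintype.card_fin, div_pow, div_pow,
    one_pow, mul_one_div]
  gcongr
  nlinarith

lemma grid_bound {d : ℕ} (hd : 1 ≤ d)
    {Ωp : Type*} [MeasureSpace Ωp] [IsProbabilityMeasure (ℙ : Measure Ωp)]
    (κ : EucSp d → ℝ) (c : ℝ) (hc0 : 0 < c)
    (hc : ∀ x ∈ unitCube d, c ≤ κ x)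
    (X : ℕ → Ωp → EucSp d) (hXmeas : ∀ i, Measurable (X i))
    (hiid : iIndepFun X ℙ)
    (hlaw : ∀ i, Measure.map (X i) ℙ
      = volume.withDensity fun x => ENNReal.ofReal (κ x))
    (δ : ℝ) (hδ : 0 < δ) :
    ∃ M > 0, ∃ r : ℕ → ℝ, (∀ n, 0 ≤ r n) ∧ Tendsto r atTop (𝓝 0) ∧
      (∀ᶠ n : ℕ in atTop, r n ^ d * n ≤ M) ∧
      ∀ᵐ ω ∂ℙ, ∀ᶠ n in atTop,
        volume {y | y ∈ unitCube d ∧ ∀ i < n, r n < dist y (X i ω)} ≤ ENNReal.ofReal δ := by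
  set η : ℝ := c * δ / 2 with hη
  have hη0 : 0 < η := by positivity
  have hd0 : d ≠ 0 := by omega
  have hdR : (0 : ℝ) < d := by exact_mod_cast hd
  set t : ℕ → ℝ := fun n => (η * n) ^ ((d : ℝ)⁻¹) with ht
  have ht0 : ∀ n, 0 ≤ t n := fun n => by positivity
  have htd : ∀ n, t n ^ d = η * n := fun n => Real.rpow_inv_natCast_pow (by positivity) hd0
  have httop : Tendsto t atTop atTop :=
    (tendsto_rpow_atTop (inv_pos.2 hdR)).comp
      (tendsto_natCast_atTop_atTop.const_mul_atTop hη0)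
  set N : ℕ → ℕ := fun n => ⌊t n⌋₊ with hNdef
  have hNtop : Tendsto N atTop atTop := tendsto_nat_floor_atTop.comp httop
  have hN1 : ∀ᶠ n in atTop, 1 ≤ N n := hNtop.eventually_ge_atTop 1
  have hNle : ∀ n, ((N n : ℝ)) ^ d ≤ η * n := fun n => by
    rw [← htd n]; gcongr; exact Nat.floor_le (ht0 n)
  refine ⟨(2 * d) ^ d / η, by positivity, fun n => d / N n, fun n => by positivity, ?_, ?_, ?_⟩
  · exact Tendsto.const_div_atTop (tendsto_natCast_atTop_atTop.comp hNtop) _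
  · filter_upwards [hN1] with n hn
    have hn' : (1 : ℝ) ≤ N n := by exact_mod_cast hn
    have h2 : t n ≤ 2 * N n := by
      have := Nat.lt_floor_add_one (t n)
      change t n < (N n : ℝ) + 1 at this
      linarith
    have h3 : η * n ≤ 2 ^ d * (N n : ℝ) ^ d := by
      rw [← htd n, ← mul_pow]; gcongr
    rw [le_div_iff₀ hη0, div_pow, div_mul_eq_mul_div, div_mul_eq_mul_div,
      div_le_iff₀ (by positivity), mul_pow]
    have : (0 : ℝ) ≤ (d : ℝ) ^ d := by positivity
    nlinarith
  · set q : ℕ → EucSp d → (Fin d → ℤ) := fun n y i => ⌊(N n : ℝ) * y i⌋ with hq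
    have hqm : ∀ n, Measurable (q n) := fun n => by
      refine measurable_pi_lambda _ fun i => ?_
      apply Int.measurable_floor.comp
      fun_prop
    set F : ℕ → Set Ωp := fun n => {ω | 1 ≤ N n ∧ ENNReal.ofReal δ <
      volume {y | y ∈ unitCube d ∧ ∀ i < n, q n (X i ω) ≠ q n y}} with hF
    have hFle : ∀ n, ℙ (F n) ≤ ENNReal.ofReal (Real.exp (-η) ^ n) := by
      intro n
      by_cases hn : 1 ≤ N n
      · have hNpos : (0 : ℝ) < N n := by exact_mod_cast hn
        have := core_bound κ c hc0 hc X hXmeas hiid hlaw (q n) (hqm n)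
          (Fintype.piFinset fun _ : Fin d => Finset.Ico (0 : ℤ) (N n)) (by
            intro y hy
            rw [Fintype.mem_piFinset]
            intro i
            have hyi := hy i
            rw [Finset.mem_Ico]
            refine ⟨Int.floor_nonneg.2 (mul_nonneg hNpos.le hyi.1.le), Int.floor_lt.2 ?_⟩
            have := hyi.2
            push_cast
            nlinarith) n δ hδ
        refine (measure_mono ?_).trans (this.trans ?_)
        · intro ω hω; exact hω.2
        · apply ENNReal.ofReal_le_ofReal
          rw [Fintype.card_piFinset]
          simp only [Int.card_Ico, sub_zero, Int.toNat_natCast, Finset.prod_const,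
            Finset.card_univ, Fintype.card_fin]
          have h2 : (2 : ℝ) ^ (N n ^ d) ≤ Real.exp (η * n) := by
            calc (2 : ℝ) ^ (N n ^ d) ≤ Real.exp 1 ^ (N n ^ d) := by
                  gcongr
                  have := Real.add_one_le_exp (1 : ℝ)
                  linarith
              _ = Real.exp ((N n : ℝ) ^ d) := by
                  rw [← Real.exp_nat_mul]; push_cast; ring_nf
              _ ≤ _ := Real.exp_le_exp.2 (hNle n)
          calc _ ≤ Real.exp (η * n) * Real.exp (- (c * δ) * n) := by gcongr
            _ = _ := by
              rw [← Real.exp_add, ← Real.exp_nat_mul]; congr 1; rw [hη]; ring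
      · have : F n = ∅ := by
          ext ω; simp [hF, hn]
        rw [this]; simp
    have hsum : ∑' n, ℙ (F n) ≠ ⊤ := by
      refine ne_top_of_le_ne_top (Summable.tsum_ofReal_ne_top ?_) (ENNReal.tsum_le_tsum hFle)
      exact summable_geometric_of_lt_one (Real.exp_pos _).le
        (Real.exp_lt_one_iff.2 (by linarith))
    filter_upwards [ae_eventually_notMem hsum] with ω hω
    filter_upwards [hω, hN1] with n hn hn1
    have : ¬ (ENNReal.ofReal δ <
      volume {y | y ∈ unitCube d ∧ ∀ i < n, q n (X i ω) ≠ q n y}) := fun h => hn ⟨hn1, h⟩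
    refine le_trans (measure_mono ?_) (not_lt.1 this)
    rintro y ⟨hy, hyi⟩
    refine ⟨hy, fun i hi heq => ?_⟩
    refine absurd (dist_le_of_floor hd (N n) hn1 y (X i ω) ?_) (not_le.2 (hyi i hi))
    intro k
    exact (congrFun heq k).symm

lemma count_bound {d : ℕ}
    {Ωp : Type*} [MeasureSpace Ωp] [IsProbabilityMeasure (ℙ : Measure Ωp)]
    (X : ℕ → Ωp → EucSp d) (hXmeas : ∀ i, Measurable (X i))
    (hiid : iIndepFun X ℙ) (μ : Measure (EucSp d))
    (hlaw : ∀ i, Measure.map (X i) ℙ = μ)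
    (B : Set (EucSp d)) (hB : MeasurableSet B) (ε : ℝ) (hμB : μ B < ENNReal.ofReal ε) :
    ∀ᵐ ω ∂ℙ, ∀ᶠ n : ℕ in atTop,
      ∑ i ∈ Finset.range n, B.indicator (fun _ => (1 : ℝ)) (X i ω) ≤ ε * n := by
  set f : EucSp d → ℝ := B.indicator (fun _ => (1 : ℝ)) with hf
  have hfm : Measurable f := measurable_const.indicator hB
  have hint : ∫ ω, f (X 0 ω) ∂ℙ < ε := by
    have : ∫ ω, f (X 0 ω) ∂ℙ = (μ B).toReal := by
      rw [← hlaw 0, ← integral_map (f := f) (hXmeas 0).aemeasurable hfm.aestronglyMeasurable, hf,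
        integral_indicator hB]
      simp [Measure.real]
    rw [this]
    exact ENNReal.toReal_lt_of_lt_ofReal hμB
  have hsl := strong_law_ae_real (μ := (ℙ : Measure Ωp)) (fun i ω => f (X i ω)) (by
      refine Integrable.of_bound (hfm.comp (hXmeas 0)).aestronglyMeasurable 1 ?_
      refine Eventually.of_forall fun ω => ?_
      simp only [hf, Set.indicator]
      split_ifs <;> simp)
    (fun i j hij => (hiid.indepFun hij).comp hfm hfm)
    (fun i => (IdentDistrib.mk (hXmeas i).aemeasurable (hXmeas 0).aemeasurable
      (by rw [hlaw, hlaw])).comp hfm)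
  filter_upwards [hsl] with ω hω
  filter_upwards [hω.eventually_lt_const hint, eventually_gt_atTop 0] with n hn hn0
  have : (0 : ℝ) < n := by exact_mod_cast hn0
  rw [div_lt_iff₀ this] at hn
  exact hn.le

/-- deterministic inclusion -/
lemma symmDiff_subset {d : ℕ} {Ωp : Type*} (X : ℕ → Ωp → EucSp d) (A K U : Set (EucSp d))
    (hAΩ : A ⊆ unitCube d) (hKA : K ⊆ A) (hAU : A ⊆ U) (ρ : ℝ)
    (hρ : Metric.thickening ρ K ⊆ U) (n : ℕ) (hn : 0 < n) (r : ℝ) (hr : r < ρ) (ω : Ωp) :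
    symmDiff A (vorEst X A n ω) ⊆ ((U \ K) ∩ unitCube d) ∪
      ({y | y ∈ unitCube d ∧ ∀ i < n, r < dist y (X i ω)} ∪
      ⋃ i ∈ (Finset.range n), ⋃ (_ : X i ω ∈ U \ K), Metric.closedBall (X i ω) r) := by
  intro y hy
  obtain ⟨hyΩ, i, hi, hnear, hdiff⟩ : y ∈ unitCube d ∧ ∃ i, i < n ∧
      (∀ j < n, dist y (X i ω) ≤ dist y (X j ω)) ∧ ¬ (y ∈ A ↔ X i ω ∈ A) := by
    rcases hy with ⟨hyA, hyn⟩ | ⟨hyn, hyA⟩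
    · refine ⟨hAΩ hyA, ?_⟩
      obtain ⟨i, hi, hmin⟩ := Finset.exists_min_image (Finset.range n)
        (fun i => dist y (X i ω)) ⟨0, Finset.mem_range.2 hn⟩
      have hi' := Finset.mem_range.1 hi
      have hm : ∀ j < n, dist y (X i ω) ≤ dist y (X j ω) :=
        fun j hj => hmin j (Finset.mem_range.2 hj)
      refine ⟨i, hi', hm, fun h => hyn ?_⟩
      simp only [vorEst, Set.mem_iUnion]
      refine ⟨i, hi', h.1 hyA, ?_, hAΩ hyA⟩
      rintro z ⟨j, hj, rfl⟩
      exact hm j hj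
    · simp only [vorEst, Set.mem_iUnion] at hyn
      obtain ⟨i, hi, hiA, hcell, hΩ⟩ := hyn
      exact ⟨hΩ, i, hi, fun j hj => hcell _ ⟨j, hj, rfl⟩, fun h => hyA (h.2 hiA)⟩
  by_cases hyB : y ∈ U \ K
  · exact Or.inl ⟨hyB, hyΩ⟩
  by_cases hbad : r < dist y (X i ω)
  · exact Or.inr (Or.inl ⟨hyΩ, fun j hj => hbad.trans_le (hnear j hj)⟩)
  rw [not_lt] at hbad
  by_cases hXB : X i ω ∈ U \ K
  · refine Or.inr (Or.inr ?_)
    simp only [Set.mem_iUnion]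
    exact ⟨i, Finset.mem_range.2 hi, hXB, Metric.mem_closedBall.2 hbad⟩
  exfalso
  have key : ∀ u v : EucSp d, u ∈ K → dist u v ≤ r → v ∈ U := fun u v hu huv =>
    hρ (Metric.mem_thickening_iff.2 ⟨u, hu, by rw [dist_comm]; exact huv.trans_lt hr⟩)
  have h1 : y ∈ U → y ∈ K := fun h => by_contra fun h' => hyB ⟨h, h'⟩
  have h2 : X i ω ∈ U → X i ω ∈ K := fun h => by_contra fun h' => hXB ⟨h, h'⟩
  apply hdiff
  constructor
  · intro hA; exact hKA (h2 (key _ _ (h1 (hAU hA)) hbad))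
  · intro hA; exact hKA (h1 (key _ _ (h2 (hAU hA)) (by rw [dist_comm]; exact hbad)))

lemma balls_bound {d : ℕ} {Ωp : Type*} (X : ℕ → Ωp → EucSp d) (B : Set (EucSp d))
    (n : ℕ) (r : ℝ) (hr : 0 ≤ r) (ω : Ωp) :
    volume (⋃ i ∈ (Finset.range n), ⋃ (_ : X i ω ∈ B), Metric.closedBall (X i ω) r) ≤
      ENNReal.ofReal ((∑ i ∈ Finset.range n, B.indicator (fun _ => (1 : ℝ)) (X i ω)) *
        (r ^ d * (volume (Metric.ball (0 : EucSp d) 1)).toReal)) := by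
  refine (measure_biUnion_finset_le _ _).trans ?_
  rw [Finset.sum_mul, ENNReal.ofReal_sum_of_nonneg]
  · refine Finset.sum_le_sum fun i _ => ?_
    by_cases h : X i ω ∈ B
    · simp only [h, Set.iUnion_true, Set.indicator_of_mem, one_mul]
      rw [Measure.addHaar_closedBall _ _ hr, ENNReal.ofReal_mul (by positivity),
        ENNReal.ofReal_toReal measure_ball_lt_top.ne, finrank_euclideanSpace_fin]
    · simp [h]
  · intro i _
    refine mul_nonneg (Set.indicator_nonneg (fun _ _ => zero_le_one) _) (by positivity)

/-- **Theorem 5.1 (second assertion).** Almost surely `|A Δ A_n| → 0` as `n → ∞`. -/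
theorem stmt1 {d : ℕ} (hd : 1 ≤ d)
    {Ωp : Type*} [MeasureSpace Ωp] [IsProbabilityMeasure (ℙ : Measure Ωp)]
    (κ : EucSp d → ℝ) (hκmeas : Measurable κ)
    (hκ0 : ∀ x ∉ unitCube d, κ x = 0)
    (hκpos : ∃ c > 0, ∀ x ∈ unitCube d, c ≤ κ x)
    (X : ℕ → Ωp → EucSp d) (hXmeas : ∀ i, Measurable (X i))
    (hiid : iIndepFun X ℙ)
    (hlaw : ∀ i, Measure.map (X i) ℙ
      = volume.withDensity fun x => ENNReal.ofReal (κ x))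
    (A : Set (EucSp d)) (hA : MeasurableSet A) (hAΩ : A ⊆ unitCube d) :
    ∀ᵐ ω ∂ℙ, Tendsto (fun n => (volume (symmDiff A (vorEst X A n ω))).toReal)
      atTop (𝓝 0) := by
  obtain ⟨c, hc0, hc⟩ := hκpos
  set μ : Measure (EucSp d) := volume.withDensity fun x => ENNReal.ofReal (κ x) with hμ
  have hμp : IsProbabilityMeasure μ := by
    rw [← hlaw 0]; exact Measure.isProbabilityMeasure_map (hXmeas 0).aemeasurable
  have hΩfin : volume (unitCube d) < ⊤ := by
    have h1 := law_lower κ c hc (unitCube d) (measurableSet_unitCube d) subset_rfl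
    have h2 : ENNReal.ofReal c * volume (unitCube d) < ⊤ := h1.trans_lt (measure_lt_top μ _)
    by_contra h
    rw [not_lt, top_le_iff] at h
    rw [h, ENNReal.mul_top (by simpa using hc0)] at h2
    exact lt_irrefl _ h2
  set ν : Measure (EucSp d) := volume.restrict (unitCube d) + μ with hν
  have : IsFiniteMeasure (volume.restrict (unitCube d)) := ⟨by simpa using hΩfin⟩
  -- the estimate at a fixed accuracy
  have main : ∀ δ : ℝ, 0 < δ → ∀ᵐ ω ∂ℙ, ∀ᶠ n in atTop,
      volume (symmDiff A (vorEst X A n ω)) ≤ ENNReal.ofReal (3 * δ) := by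
    intro δ hδ
    obtain ⟨M, hM, r, hr0, hrt, hrM, hbad⟩ :=
      grid_bound hd κ c hc0 hc X hXmeas hiid hlaw δ hδ
    set C : ℝ := (volume (Metric.ball (0 : EucSp d) 1)).toReal with hC
    have hC0 : 0 ≤ C := ENNReal.toReal_nonneg
    set ε : ℝ := min δ (δ / (M * C + 1)) with hε
    have hε0 : 0 < ε := lt_min hδ (by positivity)
    have hε2 : ENNReal.ofReal (ε / 2) ≠ 0 := by simpa using hε0
    obtain ⟨K, hKA, hK, hKm⟩ := hA.exists_isCompact_sdiff_lt (μ := ν) (measure_ne_top _ _) hε2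
    obtain ⟨U, hAU, hU, -, hUm⟩ := hA.exists_isOpen_sdiff_lt (μ := ν) (measure_ne_top _ _) hε2
    have hB : MeasurableSet (U \ K) := hU.measurableSet.diff hK.measurableSet
    have hνB : ν (U \ K) < ENNReal.ofReal ε := by
      have hs : U \ K ⊆ (U \ A) ∪ (A \ K) := by
        rintro x ⟨h1, h2⟩
        by_cases hx : x ∈ A
        · exact Or.inr ⟨hx, h2⟩
        · exact Or.inl ⟨h1, hx⟩
      calc ν (U \ K) ≤ ν (U \ A) + ν (A \ K) := (measure_mono hs).trans (measure_union_le _ _)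
        _ < ENNReal.ofReal (ε / 2) + ENNReal.ofReal (ε / 2) := ENNReal.add_lt_add hUm hKm
        _ = _ := by rw [← ENNReal.ofReal_add (by positivity) (by positivity), add_halves]
    have hμB : μ (U \ K) < ENNReal.ofReal ε := by
      refine lt_of_le_of_lt ?_ hνB
      rw [hν, Measure.add_apply]; exact le_add_self
    have hvB : volume ((U \ K) ∩ unitCube d) ≤ ENNReal.ofReal δ := by
      rw [← Measure.restrict_apply hB]
      refine le_trans ?_ (hνB.le.trans (ENNReal.ofReal_le_ofReal (min_le_left _ _)))
      rw [hν, Measure.add_apply]; exact le_self_add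
    obtain ⟨ρ, hρ0, hρ⟩ := hK.exists_thickening_subset_open hU (hKA.trans hAU)
    filter_upwards [hbad, count_bound X hXmeas hiid μ hlaw (U \ K) hB ε hμB] with ω h1 h2
    filter_upwards [h1, h2, hrM, hrt.eventually_lt_const hρ0, eventually_gt_atTop 0]
      with n g1 g2 g3 g4 g5
    refine (measure_mono (symmDiff_subset X A K U hAΩ hKA hAU ρ hρ n g5 (r n) g4 ω)).trans ?_
    refine (measure_union_le _ _).trans ?_
    have hballs := balls_bound X (U \ K) n (r n) (hr0 n) ω
    have hfin : (∑ i ∈ Finset.range n, (U \ K).indicator (fun _ => (1 : ℝ)) (X i ω)) *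
        (r n ^ d * C) ≤ δ := by
      have hrd : 0 ≤ r n ^ d := pow_nonneg (hr0 n) d
      calc _ ≤ (ε * n) * (r n ^ d * C) := by gcongr
        _ = ε * C * (r n ^ d * n) := by ring
        _ ≤ ε * C * M := by gcongr
        _ ≤ δ / (M * C + 1) * C * M := by gcongr; exact min_le_right _ _
        _ ≤ δ := by
          rw [div_mul_eq_mul_div, div_mul_eq_mul_div, div_le_iff₀ (by positivity)]
          nlinarith
    have e3 : ENNReal.ofReal (3 * δ)
        = ENNReal.ofReal δ + (ENNReal.ofReal δ + ENNReal.ofReal δ) := by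
      rw [← ENNReal.ofReal_add hδ.le hδ.le, ← ENNReal.ofReal_add hδ.le (by positivity)]
      congr 1; ring
    rw [e3]
    refine add_le_add hvB ((measure_union_le _ _).trans (add_le_add g1 ?_))
    exact hballs.trans (ENNReal.ofReal_le_ofReal hfin)
  have hall : ∀ᵐ ω ∂ℙ, ∀ k : ℕ, ∀ᶠ n in atTop,
      volume (symmDiff A (vorEst X A n ω)) ≤ ENNReal.ofReal (3 * (1 / ((k : ℝ) + 1))) :=
    ae_all_iff.2 fun k => main _ (by positivity)
  filter_upwards [hall] with ω hω
  rw [Metric.tendsto_nhds]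
  intro e he
  obtain ⟨k, hk⟩ := exists_nat_one_div_lt (show 0 < e / 3 by positivity)
  filter_upwards [hω k] with n hn
  rw [Real.dist_eq, sub_zero, abs_of_nonneg ENNReal.toReal_nonneg]
  have := ENNReal.toReal_le_of_le_ofReal (by positivity) hn
  linarith
end
end

section
/- The random variables |A Δ A_n| converge to 0 in L¹; that is, E[|A Δ A_n|] → 0 as n → ∞. -/
open MeasureTheory ProbabilityTheory Filter Topology
open scoped RealInnerProductSpace

noncomputable section

lemma aux_radius {E : Type*} [MetricSpace E] [MeasurableSpace E] [OpensMeasurableSpace E]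
    (μ : Measure E) [IsProbabilityMeasure μ] (y : E)
    (hs : ∀ r, μ (Metric.sphere y r) = 0) (t δ : ℝ) (ht : 0 < t) (hδ : 0 ≤ δ)
    (h : t ≤ μ.real (Metric.closedBall y δ)) :
    ∃ r, 0 < r ∧ r ≤ δ ∧ μ.real (Metric.closedBall y r) = t := by
  have hc : Continuous (fun r => μ.real (Metric.closedBall y r)) := by
    have : (fun r => μ.real (Metric.closedBall y r)) =
        fun r => ∫ x, (Metric.closedBall y r).indicator (1 : E → ℝ) x ∂μ := by
      ext r
      rw [integral_indicator_one Metric.isClosed_closedBall.measurableSet]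
    rw [this, continuous_iff_continuousAt]
    intro r
    refine continuousAt_of_dominated (bound := fun _ => 1) ?_ ?_ (integrable_const _) ?_
    · exact Eventually.of_forall fun r => ((measurable_one.indicator
        Metric.isClosed_closedBall.measurableSet).aestronglyMeasurable)
    · refine Eventually.of_forall fun r => Eventually.of_forall fun x => ?_
      by_cases hx : x ∈ Metric.closedBall y r <;> simp [hx]
    · have h0 : ∀ᵐ x ∂μ, x ∉ Metric.sphere y r := measure_eq_zero_iff_ae_notMem.1 (hs r)
      filter_upwards [h0] with x hx
      have hx' : dist x y ≠ r := by simpa using hx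
      rcases lt_or_gt_of_ne hx' with hlt | hgt
      · have : (fun r' => (Metric.closedBall y r').indicator (1 : E → ℝ) x) =ᶠ[𝓝 r]
            fun _ => 1 := by
          filter_upwards [lt_mem_nhds hlt] with r' hr'
          simp [Set.indicator, hr'.le]
        exact (continuousAt_const).congr this.symm
      · have : (fun r' => (Metric.closedBall y r').indicator (1 : E → ℝ) x) =ᶠ[𝓝 r]
            fun _ => 0 := by
          filter_upwards [gt_mem_nhds hgt] with r' hr'
          simp [Set.indicator, hr']
        exact (continuousAt_const).congr this.symm
  have h0 : μ.real (Metric.closedBall y 0) = 0 := by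
    have := hs 0
    rw [Metric.sphere_zero] at this
    simp [Measure.real, this]
  obtain ⟨r, hr, hrt⟩ := intermediate_value_Icc hδ hc.continuousOn
    (show t ∈ Set.Icc _ _ from ⟨by simp only [h0]; exact ht.le, h⟩)
  refine ⟨r, lt_of_le_of_ne hr.1 ?_, hr.2, hrt⟩
  rintro rfl
  simp only [h0] at hrt
  exact ht.ne hrt

lemma aux_prob {E Ωp : Type*} [MeasurableSpace E] [MeasurableSpace Ωp]
    (P : Measure Ωp) [IsProbabilityMeasure P] (μ : Measure E) [IsProbabilityMeasure μ]
    (X : ℕ → Ωp → E) (hX : ∀ i, Measurable (X i)) (hi : iIndepFun X P)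
    (hl : ∀ i, P.map (X i) = μ) (C B : Set E) (hC : MeasurableSet C) (hB : MeasurableSet B)
    (n : ℕ) :
    P.real ({ω | ∀ i < n, X i ω ∉ C} ∪ {ω | ∃ i < n, X i ω ∈ C \ B})
      ≤ (1 - μ.real C) ^ n + n * μ.real (C \ B) := by
  have hm : ∀ i (S : Set E), MeasurableSet S → P.real (X i ⁻¹' S) = μ.real S := by
    intro i S hS
    rw [← hl i, map_measureReal_apply (hX i) hS]
  refine (measureReal_union_le _ _).trans (add_le_add ?_ ?_)
  · have h1 : {ω | ∀ i < n, X i ω ∉ C} = ⋂ i ∈ Finset.range n, X i ⁻¹' Cᶜ := by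
      ext ω; simp
    rw [h1, Measure.real, hi.measure_inter_preimage_eq_mul (S := Finset.range n)
      (sets := fun _ => Cᶜ) (fun _ _ => hC.compl), ENNReal.toReal_prod]
    have h2 : ∀ i ∈ Finset.range n, (P (X i ⁻¹' Cᶜ)).toReal = 1 - μ.real C := by
      intro i _
      rw [← probReal_compl_eq_one_sub hC, ← hm i _ hC.compl, Measure.real]
    rw [Finset.prod_congr rfl h2]
    simp
  · have h1 : {ω | ∃ i < n, X i ω ∈ C \ B} = ⋃ i ∈ Finset.range n, X i ⁻¹' (C \ B) := by
      ext ω; simp; grind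
    rw [h1]
    refine (measureReal_biUnion_finset_le _ _).trans ?_
    rw [Finset.sum_congr rfl (fun i _ => hm i _ (hC.diff hB))]
    simp

lemma aux_lim {E Ωp : Type*} [MetricSpace E] [MeasurableSpace E] [OpensMeasurableSpace E]
    [MeasurableSpace Ωp]
    (P : Measure Ωp) [IsProbabilityMeasure P] (μ : Measure E) [IsProbabilityMeasure μ]
    (X : ℕ → Ωp → E) (hX : ∀ i, Measurable (X i)) (hi : iIndepFun X P)
    (hl : ∀ i, P.map (X i) = μ) (B : Set E) (hB : MeasurableSet B) (y : E)
    (hs : ∀ r, μ (Metric.sphere y r) = 0)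
    (hpos : ∀ δ > 0, 0 < μ.real (Metric.closedBall y δ))
    (hd : Tendsto (fun r => μ (B ∩ Metric.closedBall y r) / μ (Metric.closedBall y r))
      (𝓝[>] 0) (𝓝 1)) :
    Tendsto (fun n => P {ω | ∃ i < n, X i ω ∉ B ∧ ∀ j < n, dist y (X i ω) ≤ dist y (X j ω)})
      atTop (𝓝 0) := by
  have key : ∀ ε > 0, ∀ᶠ n : ℕ in atTop,
      P.real {ω | ∃ i < n, X i ω ∉ B ∧ ∀ j < n, dist y (X i ω) ≤ dist y (X j ω)} ≤ ε := by
    intro ε hε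
    obtain ⟨M, hM0, hM⟩ : ∃ M : ℝ, 0 < M ∧ Real.exp (-M) ≤ ε / 2 := by
      have := (Real.tendsto_exp_neg_atTop_nhds_zero.eventually
        (ge_mem_nhds (show (0:ℝ) < ε / 2 by positivity))).and (eventually_gt_atTop 0)
      obtain ⟨M, h1, h2⟩ := this.exists
      exact ⟨M, h2, h1⟩
    have hd' : Tendsto (fun r => μ.real (B ∩ Metric.closedBall y r) /
        μ.real (Metric.closedBall y r)) (𝓝[>] 0) (𝓝 1) := by
      have := (ENNReal.tendsto_toReal (ENNReal.one_ne_top)).comp hd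
      simpa [Function.comp_def, Measure.real, ENNReal.toReal_div] using this
    have hη : 0 < ε / (2 * M) := by positivity
    have he := hd'.eventually (lt_mem_nhds (show 1 - ε / (2 * M) < 1 by linarith))
    obtain ⟨δ, hδ, hδ'⟩ := mem_nhdsGT_iff_exists_Ioc_subset.1 he
    have hδ0 : 0 < δ := hδ
    have hn : ∀ᶠ n : ℕ in atTop, M / (n : ℝ) ≤ μ.real (Metric.closedBall y δ) :=
      (tendsto_const_div_atTop_nhds_zero_nat M).eventually (ge_mem_nhds (hpos δ hδ0))
    filter_upwards [hn, eventually_gt_atTop 0] with n hn hn0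
    have hnR : (0:ℝ) < n := by exact_mod_cast hn0
    obtain ⟨r, hr0, hrδ, hr⟩ := aux_radius μ y hs (M / n) δ (by positivity) hδ0.le hn
    have hCm : MeasurableSet (Metric.closedBall y r) := Metric.isClosed_closedBall.measurableSet
    have hr1 : M / n ≤ 1 := by rw [← hr]; exact measureReal_le_one
    have hMn : M ≤ n := by rwa [div_le_one hnR] at hr1
    have hdiff : μ.real (Metric.closedBall y r \ B) ≤ ε / (2 * M) * (M / n) := by
      have h1 : 1 - ε / (2 * M) < μ.real (B ∩ Metric.closedBall y r) /
        μ.real (Metric.closedBall y r) := hδ' ⟨hr0, hrδ⟩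
      rw [lt_div_iff₀ (hpos r hr0), hr] at h1
      have h2 := measureReal_sdiff_add_inter (μ := μ) (s := Metric.closedBall y r) hB
      rw [Set.inter_comm, hr] at h2
      nlinarith
    calc _ ≤ P.real ({ω | ∀ i < n, X i ω ∉ Metric.closedBall y r} ∪
          {ω | ∃ i < n, X i ω ∈ Metric.closedBall y r \ B}) := by
          refine measureReal_mono ?_
          rintro ω ⟨i, hin, hiB, hmin⟩
          by_cases hC : X i ω ∈ Metric.closedBall y r
          · exact Or.inr ⟨i, hin, hC, hiB⟩
          · refine Or.inl fun j hj hjC => hC ?_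
            rw [Metric.mem_closedBall'] at hjC ⊢
            exact (hmin j hj).trans hjC
      _ ≤ _ := aux_prob P μ X hX hi hl _ B hCm hB n
      _ ≤ Real.exp (-M) + n * (ε / (2 * M) * (M / n)) := by
          rw [hr]
          gcongr
          exact Real.one_sub_div_pow_le_exp_neg hMn
      _ = Real.exp (-M) + ε / 2 := by congr 1; field_simp
      _ ≤ ε := by linarith
  rw [ENNReal.tendsto_nhds_zero]
  intro ε hε
  by_cases hT : ε = ⊤
  · simp [hT]
  filter_upwards [key ε.toReal (ENNReal.toReal_pos hε.ne' hT)] with n hn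
  exact (ENNReal.toReal_le_toReal (measure_ne_top _ _) hT).1 hn

lemma aux_cube_open (d : ℕ) : IsOpen (unitCube d) := by
  have : unitCube d = ⋂ i, (fun x : EucSp d => x i) ⁻¹' Set.Ioo (0:ℝ) 1 := by
    ext x; simp [unitCube]
  rw [this]
  exact isOpen_iInter_of_finite fun i => isOpen_Ioo.preimage (by fun_prop)

lemma aux_cube_vol (d : ℕ) : volume (unitCube d) < ⊤ := by
  have : unitCube d ⊆ (WithLp.ofLp ⁻¹' (Set.Icc (0 : Fin d → ℝ) 1)) := by
    intro x hx
    exact ⟨fun i => (hx i).1.le, fun i => (hx i).2.le⟩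
  refine (measure_mono this).trans_lt ?_
  rw [(PiLp.volume_preserving_ofLp (Fin d)).measure_preimage
    measurableSet_Icc.nullMeasurableSet]
  exact isCompact_Icc.measure_lt_top

lemma aux_mem_vorEst {d : ℕ} {Ωp : Type*} (X : ℕ → Ωp → EucSp d) (A : Set (EucSp d))
    (n : ℕ) (ω : Ωp) (y : EucSp d) :
    y ∈ vorEst X A n ω ↔ y ∈ unitCube d ∧
      ∃ i < n, X i ω ∈ A ∧ ∀ j < n, dist y (X i ω) ≤ dist y (X j ω) := by
  simp only [vorEst, vorCell, sample, Set.mem_iUnion, Set.mem_inter_iff, Set.mem_ofPred_eq,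
    Set.mem_Iio, Set.forall_mem_image, exists_prop]
  grind

/-- `|A Δ A_n| → 0` in `L¹`: `E[|A Δ A_n|] → 0` as `n → ∞`. -/
theorem stmt3 {d : ℕ} (hd : 1 ≤ d)
    {Ωp : Type*} [MeasureSpace Ωp] [IsProbabilityMeasure (ℙ : Measure Ωp)]
    (κ : EucSp d → ℝ) (hκmeas : Measurable κ)
    (hκ0 : ∀ x ∉ unitCube d, κ x = 0)
    (hκpos : ∃ c > 0, ∀ x ∈ unitCube d, c ≤ κ x)
    (X : ℕ → Ωp → EucSp d) (hXmeas : ∀ i, Measurable (X i))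
    (hiid : iIndepFun X ℙ)
    (hlaw : ∀ i, Measure.map (X i) ℙ
      = volume.withDensity fun x => ENNReal.ofReal (κ x))
    (A : Set (EucSp d)) (hA : MeasurableSet A) (hAΩ : A ⊆ unitCube d) :
    Tendsto (fun n => ∫ ω, (volume (symmDiff A (vorEst X A n ω))).toReal ∂ℙ)
      atTop (𝓝 0) := by
  obtain ⟨c, hc, hκc⟩ := hκpos
  have hUo := aux_cube_open d
  have hUm := hUo.measurableSet
  set μ : Measure (EucSp d) := volume.withDensity fun x => ENNReal.ofReal (κ x) with hμ
  have hμp : IsProbabilityMeasure μ := by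
    rw [← hlaw 0]; exact Measure.isProbabilityMeasure_map (hXmeas 0).aemeasurable
  have hlow : ∀ s, MeasurableSet s → ENNReal.ofReal c * volume (s ∩ unitCube d) ≤ μ s := by
    intro s hs
    rw [hμ, withDensity_apply _ hs, ← setLIntegral_const]
    calc _ ≤ ∫⁻ x in s ∩ unitCube d, ENNReal.ofReal (κ x) :=
          setLIntegral_mono (by fun_prop) fun x hx => ENNReal.ofReal_le_ofReal (hκc x hx.2)
      _ ≤ _ := lintegral_mono_set Set.inter_subset_left
  have hcE : ENNReal.ofReal c ≠ 0 := by simpa using hc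
  have hac : volume.restrict (unitCube d) ≪ μ := by
    refine Measure.AbsolutelyContinuous.mk fun s hs h0 => ?_
    rw [Measure.restrict_apply hs]
    have := hlow s hs
    rw [h0, nonpos_iff_eq_zero, mul_eq_zero] at this
    exact this.resolve_left hcE
  have hne : Nonempty (Fin d) := ⟨⟨0, hd⟩⟩
  have hsph : ∀ (y : EucSp d) r, μ (Metric.sphere y r) = 0 := fun y r =>
    withDensity_absolutelyContinuous _ _ (Measure.addHaar_sphere volume y r)
  have hpos : ∀ y ∈ unitCube d, ∀ δ > 0, 0 < μ.real (Metric.closedBall y δ) := by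
    intro y hy δ hδ
    refine ENNReal.toReal_pos ?_ (measure_ne_top _ _)
    have h1 := hlow (Metric.closedBall y δ) Metric.isClosed_closedBall.measurableSet
    have h2 : 0 < volume (Metric.closedBall y δ ∩ unitCube d) := by
      refine lt_of_lt_of_le ((Metric.isOpen_ball.inter hUo).measure_pos volume
        ⟨y, Metric.mem_ball_self hδ, hy⟩)
        (measure_mono (Set.inter_subset_inter_left _ Metric.ball_subset_closedBall))
    exact ((ENNReal.mul_pos hcE h2.ne').trans_le h1).ne'
  -- the graph of the symmetric difference
  let S : ℕ → Set (Ωp × EucSp d) := fun n => {p | p.2 ∈ symmDiff A (vorEst X A n p.1)}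
  have hSm : ∀ n, MeasurableSet (S n) := by
    intro n
    have h1 : MeasurableSet {p : Ωp × EucSp d | p.2 ∈ vorEst X A n p.1} := by
      have : {p : Ωp × EucSp d | p.2 ∈ vorEst X A n p.1} =
          (Prod.snd ⁻¹' unitCube d) ∩ ⋃ i ∈ Set.Iio n, (((fun p => X i p.1) ⁻¹' A) ∩
            ⋂ j ∈ Set.Iio n, {p | dist p.2 (X i p.1) ≤ dist p.2 (X j p.1)}) := by
        ext p
        simp only [aux_mem_vorEst, Set.mem_ofPred_eq, Set.mem_inter_iff, Set.mem_preimage,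
          Set.mem_iUnion, Set.mem_iInter, Set.mem_Iio, exists_prop]
      rw [this]
      refine (measurable_snd hUm).inter (MeasurableSet.biUnion (Set.to_countable _) fun i _ =>
        ((((hXmeas i).comp measurable_fst) hA).inter
          (MeasurableSet.biInter (Set.to_countable _) fun j _ => ?_)))
      have hi : Measurable fun p : Ωp × EucSp d => X i p.1 := (hXmeas i).comp measurable_fst
      have hj : Measurable fun p : Ωp × EucSp d => X j p.1 := (hXmeas j).comp measurable_fst
      exact measurableSet_le (measurable_snd.dist hi) (measurable_snd.dist hj)
    have h2 : MeasurableSet {p : Ωp × EucSp d | p.2 ∈ A} := measurable_snd hA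
    exact h2.symmDiff h1
  have hsub : ∀ n ω, symmDiff A (vorEst X A n ω) ⊆ unitCube d := by
    rintro n ω y (⟨h, -⟩ | ⟨h, -⟩)
    · exact hAΩ h
    · exact ((aux_mem_vorEst X A n ω y).1 h).1
  have hswap : ∀ n, ∫⁻ ω, volume (symmDiff A (vorEst X A n ω)) ∂ℙ =
      ∫⁻ y in unitCube d, ℙ {ω | y ∈ symmDiff A (vorEst X A n ω)} := by
    intro n
    have h1 := Measure.prod_apply (μ := (ℙ : Measure Ωp))
      (ν := volume.restrict (unitCube d)) (hSm n)
    rw [Measure.prod_apply_symm (hSm n)] at h1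
    refine Eq.trans (lintegral_congr fun ω => ?_) h1.symm
    rw [Measure.restrict_apply (measurable_prodMk_left (hSm n))]
    congr 1
    ext y
    exact ⟨fun h => ⟨h, hsub n ω h⟩, fun h => h.1⟩
  have hmeasω : ∀ n, Measurable fun ω => volume (symmDiff A (vorEst X A n ω)) :=
    fun n => measurable_measure_prodMk_left (hSm n)
  have hmeasy : ∀ n, Measurable fun y => ℙ {ω | y ∈ symmDiff A (vorEst X A n ω)} :=
    fun n => measurable_measure_prodMk_right (hSm n)
  have hptw : ∀ᵐ y ∂(volume.restrict (unitCube d)),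
      Tendsto (fun n => ℙ {ω | y ∈ symmDiff A (vorEst X A n ω)}) atTop (𝓝 0) := by
    filter_upwards [hac.ae_le (Besicovitch.ae_tendsto_measure_inter_div_of_measurableSet μ hA),
      hac.ae_le (Besicovitch.ae_tendsto_measure_inter_div_of_measurableSet μ hA.compl),
      ae_restrict_mem hUm] with y hy1 hy2 hyU
    by_cases hyA : y ∈ A
    · have hL := aux_lim ℙ μ X hXmeas hiid hlaw A hA y (hsph y) (hpos y hyU)
        (by simpa [hyA] using hy1)
      refine tendsto_of_tendsto_of_tendsto_of_le_of_le' tendsto_const_nhds hL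
        (Eventually.of_forall fun _ => zero_le) ?_
      filter_upwards [eventually_gt_atTop 0] with n hn
      refine measure_mono fun ω hω => ?_
      obtain ⟨i, hi, hmin⟩ := Finset.exists_min_image (Finset.range n)
        (fun i => dist y (X i ω)) ⟨0, by simpa using hn⟩
      rw [Finset.mem_range] at hi
      have hmin' : ∀ j < n, dist y (X i ω) ≤ dist y (X j ω) :=
        fun j hj => hmin j (Finset.mem_range.2 hj)
      refine ⟨i, hi, fun hiA => ?_, hmin'⟩
      rcases hω with ⟨-, h⟩ | ⟨-, h⟩
      · exact h ((aux_mem_vorEst X A n ω y).2 ⟨hyU, i, hi, hiA, hmin'⟩)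
      · exact h hyA
    · have hL := aux_lim ℙ μ X hXmeas hiid hlaw Aᶜ hA.compl y (hsph y) (hpos y hyU)
        (by simpa [hyA] using hy2)
      refine tendsto_of_tendsto_of_tendsto_of_le_of_le' tendsto_const_nhds hL
        (Eventually.of_forall fun _ => zero_le) ?_
      refine Eventually.of_forall fun n => measure_mono fun ω hω => ?_
      rcases hω with ⟨h, -⟩ | ⟨h, -⟩
      · exact absurd h hyA
      · obtain ⟨-, i, hi, hiA, hmin⟩ := (aux_mem_vorEst X A n ω y).1 h
        exact ⟨i, hi, fun h => h hiA, hmin⟩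
  have hlim : Tendsto (fun n => ∫⁻ ω, volume (symmDiff A (vorEst X A n ω)) ∂ℙ) atTop (𝓝 0) := by
    simp_rw [hswap]
    have := tendsto_lintegral_of_dominated_convergence (μ := volume.restrict (unitCube d))
      (f := fun _ => 0) (fun _ => 1) hmeasy
      (fun n => Eventually.of_forall fun y => prob_le_one)
      (by simpa using (aux_cube_vol d).ne) hptw
    simpa using this
  have hint : ∀ n, ∫ ω, (volume (symmDiff A (vorEst X A n ω))).toReal ∂ℙ =
      (∫⁻ ω, volume (symmDiff A (vorEst X A n ω)) ∂ℙ).toReal := fun n =>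
    integral_toReal (hmeasω n).aemeasurable
      (Eventually.of_forall fun ω => (measure_mono (hsub n ω)).trans_lt (aux_cube_vol d))
  simp_rw [hint]
  simpa [Function.comp_def] using (ENNReal.tendsto_toReal ENNReal.zero_ne_top).comp hlim
end
end
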